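/- Let n ≥ 2 and let γ : ℤ → ℝ² be a convex half-area 2n-polygon: γ(i+2n) = γ(i) for all i, γ is in strictly convex position positively oriented ([γ(i+1) − γ(i), γ(j) − γ(i)] > 0 for all i and all j not congruent to i or i+1 mod 2n), and a⁺(i) = a⁻(i+n) for all i. Suppose γ is skew-symmetric with constant c ≠ 1: there exists c > 0, c ≠ 1, such that λ(i) = c for all even i and λ(i) = 1/c for all odd i, where λ(i) := ‖γ(i+n) − γ(i+1)‖ / ‖γ(i+n+1) − γ(i)‖. Then δ(i−1) · δ(i) < 0 for every i; that is, every vertex of γ is a pt-vertex, so the envelope of bisecting lines of γ has exactly n cusps. -/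

import Mathlib

/-- The 2×2 determinant `[P,Q] = p₁q₂ − p₂q₁` of two vectors in the plane. -/
noncomputable def det2 (P Q : ℝ × ℝ) : ℝ := P.1 * Q.2 - P.2 * Q.1

/-- The Euclidean length of a vector in the plane. -/
noncomputable def elen (P : ℝ × ℝ) : ℝ := Real.sqrt (P.1 ^ 2 + P.2 ^ 2)

theorem elen_smul (t : ℝ) (ht : 0 ≤ t) (P : ℝ × ℝ) : elen (t • P) = t * elen P := by
  simp only [elen, Prod.smul_fst, Prod.smul_snd, smul_eq_mul]
  rw [show (t * P.1) ^ 2 + (t * P.2) ^ 2 = t ^ 2 * (P.1 ^ 2 + P.2 ^ 2) by ring,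
    Real.sqrt_mul (sq_nonneg t), Real.sqrt_sq ht]

theorem elen_pos_of_det2_pos {P Q : ℝ × ℝ} (h : 0 < det2 P Q) : 0 < elen Q := by
  apply Real.sqrt_pos.2
  by_contra hle
  have h1 : Q.1 = 0 := by nlinarith [sq_nonneg Q.1, sq_nonneg Q.2]
  have h2 : Q.2 = 0 := by nlinarith [sq_nonneg Q.1, sq_nonneg Q.2]
  simp [det2, h1, h2] at h

/-- If the triangles `ABC` and `BCD` have equal areas, then `BC` and `AD` are parallel, and the
determinant of the sides `AB`, `CD` is governed by the ratio of the lengths of `BC` and `AD`. -/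
theorem det2_sides_of_equal_areas {A B C D : ℝ × ℝ}
    (hABC : 0 < det2 (B - A) (C - A)) (hABD : 0 < det2 (B - A) (D - A))
    (harea : det2 (B - A) (C - A) = det2 (D - C) (B - D)) :
    det2 (B - A) (D - C) = (1 - elen (C - B) / elen (D - A)) * det2 (B - A) (D - A) := by
  have hpar : C - B = (det2 (B - A) (C - A) / det2 (B - A) (D - A)) • (D - A) := by
    have hne := hABD.ne'
    ext <;> simp only [Prod.smul_fst, Prod.smul_snd, smul_eq_mul] <;> field_simp <;>
      simp only [det2, Prod.fst_sub, Prod.snd_sub] at harea ⊢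
    · linear_combination -(B.1 - A.1) * harea
    · linear_combination -(B.2 - A.2) * harea
  have hratio : elen (C - B) / elen (D - A) = det2 (B - A) (C - A) / det2 (B - A) (D - A) := by
    rw [hpar, elen_smul _ (div_pos hABC hABD).le,
      mul_div_cancel_right₀ _ (elen_pos_of_det2_pos hABD).ne']
  rw [hratio, sub_mul, div_mul_cancel₀ _ hABD.ne']
  simp only [det2, Prod.fst_sub, Prod.snd_sub]
  ring

theorem one_sub_mul_one_sub_one_div_neg {c : ℝ} (hc : 0 < c) (hc1 : c ≠ 1) :
    (1 - c) * (1 - 1 / c) < 0 := by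
  have h : (1 - c) * (1 - 1 / c) = -((1 - c) ^ 2 / c) := by field_simp; ring
  rw [h]
  have : 0 < (1 - c) ^ 2 := sq_pos_of_ne_zero (sub_ne_zero.2 hc1.symm)
  exact neg_neg_of_pos (div_pos this hc)

theorem skew_symmetric_has_n_cusps
    (n : ℕ) (hn : 2 ≤ n) (γ : ℤ → ℝ × ℝ)
    (hper : ∀ i : ℤ, γ (i + 2 * n) = γ i)
    (hconv : ∀ i j : ℤ, ¬ ((2 * (n:ℤ)) ∣ (j - i)) → ¬ ((2 * (n:ℤ)) ∣ (j - (i + 1))) →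
      0 < det2 (γ (i + 1) - γ i) (γ j - γ i))
    (v : ℤ → ℝ × ℝ) (hv : ∀ i, v i = γ (i + n) - γ i)
    (ap : ℤ → ℝ) (hap : ∀ i, ap i = det2 (γ (i + 1) - γ i) (v i))
    (am : ℤ → ℝ) (ham : ∀ i, am i = det2 (γ (i + 1) - γ i) (v (i + 1)))
    (δ : ℤ → ℝ) (hδ : ∀ i, δ i = det2 (γ (i + 1) - γ i) (γ (i + n + 1) - γ (i + n)))
    (hha : ∀ i : ℤ, ap i = am (i + n))
    (lam : ℤ → ℝ) (hlam : ∀ i, lam i = elen (γ (i + n) - γ (i + 1)) / elen (γ (i + n + 1) - γ i))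
    (c : ℝ) (hc : 0 < c) (hc1 : c ≠ 1)
    (hskew : ∀ i : ℤ, (Even i → lam i = c) ∧ (Odd i → lam i = 1 / c)) :
    ∀ i : ℤ, δ (i - 1) * δ i < 0 := by
  have hnd : ∀ k : ℤ, 0 < k → k < 2 * n → ¬ (2 * (n : ℤ)) ∣ k := fun k h0 h1 h =>
    absurd (Int.le_of_dvd h0 h) (not_le.2 h1)
  have hD : ∀ i, 0 < det2 (γ (i + 1) - γ i) (γ (i + n + 1) - γ i) := fun i =>
    hconv i _ (hnd _ (by lia) (by lia)) (hnd _ (by lia) (by lia))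
  have hC : ∀ i, 0 < det2 (γ (i + 1) - γ i) (γ (i + n) - γ i) := fun i =>
    hconv i _ (hnd _ (by lia) (by lia)) (hnd _ (by lia) (by lia))
  have hδlam : ∀ i, δ i = (1 - lam i) * det2 (γ (i + 1) - γ i) (γ (i + n + 1) - γ i) := by
    intro i
    rw [hδ, hlam]
    refine det2_sides_of_equal_areas (hC i) (hD i) ?_
    have h := hha i
    rwa [hap, ham, hv, hv, show i + n + 1 + n = i + 1 + 2 * (n : ℤ) by ring, hper] at h
  intro i
  have hneg : (1 - lam (i - 1)) * (1 - lam i) < 0 := by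
    have hcneg := one_sub_mul_one_sub_one_div_neg hc hc1
    rcases Int.even_or_odd i with h | h
    · rw [(hskew i).1 h, (hskew (i - 1)).2 (h.sub_odd odd_one), mul_comm]
      exact hcneg
    · rw [(hskew i).2 h, (hskew (i - 1)).1 (h.sub_odd odd_one)]
      exact hcneg
  rw [hδlam, hδlam, mul_mul_mul_comm]
  exact mul_neg_of_neg_of_pos hneg (mul_pos (hD _) (hD _))
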